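/- Let F = ℚ(a, t) be the field of rational functions in two variables a, t over ℚ and fix γ ∈ F. If ψ is any function from Young diagrams to F satisfying, for every nonempty Young diagram μ, the recursion (t − t^{−1}) · C_μ(t) · ψ_μ = γ · Σ_{λ : λ+□=μ} (a − a^{−1} t^{2 c(μ∖λ)}) · ψ_λ, then for every Young diagram λ one has ψ_λ = ψ_∅ · γ^{|λ|} · ∏_{□∈λ} (a t^{−c(□)} − a^{−1} t^{c(□)}) / (t^{h(□)} − t^{−h(□)}). In particular any solution of the recursion is a scalar multiple of this hook-content solution. -/

import Mathlib

open Finset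

/-- The content of a cell `(i, j)` (0-indexed) of a Young diagram: `j - i`. -/
def cellContent (c : ℕ × ℕ) : ℤ := (c.2 : ℤ) - (c.1 : ℤ)

/-- The arm length of a cell: number of cells strictly to its right in its row. -/
def armLen (μ : YoungDiagram) (c : ℕ × ℕ) : ℕ := μ.rowLen c.1 - (c.2 + 1)

/-- The leg length of a cell: number of cells strictly below it in its column. -/
def legLen (μ : YoungDiagram) (c : ℕ × ℕ) : ℕ := μ.colLen c.2 - (c.1 + 1)

/-- The hook length of a cell: arm + leg + 1. -/
def hookLen (μ : YoungDiagram) (c : ℕ × ℕ) : ℕ := armLen μ c + legLen μ c + 1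

/-- `AddCell l m` means `m` is obtained from `l` by adding exactly one cell. -/
def AddCell (l m : YoungDiagram) : Prop := l.cells ⊆ m.cells ∧ m.card = l.card + 1

/-- The content of the unique cell of `m` not in `l` (when `AddCell l m`),
expressed as the sum over the one-element difference `m \ l`. -/
def newContent (l m : YoungDiagram) : ℤ := ∑ c ∈ m.cells \ l.cells, cellContent c

/-- The field `ℚ(a,t)` of rational functions in two variables over `ℚ`, realized as
rational functions in `t` over the field `ℚ(a)`. -/
abbrev F2 : Type := RatFunc (RatFunc ℚ)

/-- The variable `a` of `ℚ(a,t)`. -/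
noncomputable def va : F2 := RatFunc.C RatFunc.X

/-- The variable `t` of `ℚ(a,t)`. -/
noncomputable def vt : F2 := RatFunc.X

/-- The content polynomial `c_μ(q) = Σ_{□∈μ} q^{c(□)}` evaluated at `q = t²`,
as an element of `ℚ(a,t)`. -/
noncomputable def contentPolyT2 (μ : YoungDiagram) : F2 :=
  ∑ c ∈ μ.cells, vt ^ (2 * cellContent c)


section Alg
variable {K : Type*} [Field K]

lemma lag_sum (s : Finset ℕ) (hs : 0 < #s) (v g : ℕ → K) (hv : Set.InjOn v s) :
    ∑ i ∈ s, (∏ j ∈ s, (v i - g j)) / ∏ j ∈ s.erase i, (v i - v j)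
      = ∑ i ∈ s, v i - ∑ i ∈ s, g i := by
  classical
  set P : Polynomial K := ∏ i ∈ s, (Polynomial.X - Polynomial.C (g i)) with hP
  set Q : Polynomial K := ∏ i ∈ s, (Polynomial.X - Polynomial.C (v i)) with hQ
  have hPm : P.Monic := Polynomial.monic_prod_X_sub_C _ _
  have hQm : Q.Monic := Polynomial.monic_prod_X_sub_C _ _
  have hPd : P.degree = #s := by
    rw [hP, Polynomial.degree_prod]; simp
  have hQd : Q.degree = #s := by
    rw [hQ, Polynomial.degree_prod]; simp
  have hd : (P - Q).degree < #s := by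
    rw [← hPd]
    apply Polynomial.degree_sub_lt_left (by rw [hPd, hQd]) hPm.ne_zero
    rw [hPm.leadingCoeff, hQm.leadingCoeff]
  have h := Lagrange.coeff_eq_sum hv hd
  rw [Polynomial.coeff_sub, hP, hQ, Polynomial.prod_X_sub_C_coeff_card_pred _ _ hs,
    Polynomial.prod_X_sub_C_coeff_card_pred _ _ hs] at h
  have e : ∀ i ∈ s, (P - Q).eval (v i) = ∏ j ∈ s, (v i - g j) := by
    intro i hi
    have : Q.eval (v i) = 0 := by
      rw [hQ, Polynomial.eval_prod]
      exact Finset.prod_eq_zero hi (by simp)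
    rw [Polynomial.eval_sub, this, hP, Polynomial.eval_prod]; simp
  rw [← hP, ← hQ] at h
  rw [Finset.sum_congr rfl (fun i hi => by rw [← e i hi]), ← h]; ring

lemma key_id (N : ℕ) (z : ℕ → K) (q : K) (hq : q ≠ 1) (hz : Set.InjOn z (range N))
    (hz0 : ∀ i < N, z i ≠ 0) :
    ∑ i ∈ range N, (z i - 1) * ∏ k ∈ (range N).erase i, ((z i - q * z k) / (z i - z k))
      = ∑ i ∈ range N, z i - ∑ i ∈ range N, q ^ i := by
  classical
  have hv : Set.InjOn (fun i => if i < N then z i else 0) (range (N+1)) := by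
    intro i hi j hj hij
    simp only [coe_range, Set.mem_Iio] at hi hj
    simp only at hij
    split_ifs at hij with h1 h2 h2
    · exact hz (by simpa using h1) (by simpa using h2) hij
    · exact absurd hij (hz0 i h1)
    · exact absurd hij.symm (hz0 j h2)
    · omega
  have h := lag_sum (range (N+1)) (by simp) _ (fun i => if i < N then q * z i else 1) hv
  rw [sum_range_succ, sum_range_succ, sum_range_succ] at h
  have e1 : (range (N+1)).erase N = range N := by
    ext x; simp; omega
  have hlt : ∀ {f g : ℕ → K}, ∑ i ∈ range N, (if i < N then f i else g i) = ∑ i ∈ range N, f i :=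
    fun {f g} => sum_congr rfl (fun i hi => if_pos (mem_range.1 hi))
  have e2 : (∏ j ∈ range (N+1), ((if N < N then z N else 0) - if j < N then q * z j else 1))
      / ∏ j ∈ (range (N+1)).erase N, ((if N < N then z N else 0) - if j < N then z j else 0)
      = - q ^ N := by
    rw [e1, prod_range_succ, mul_div_right_comm, ← prod_div_distrib]
    rw [prod_congr rfl (g := fun _ => q)]
    · simp
    · intro i hi
      have := hz0 i (mem_range.1 hi)
      simp only [mem_range.1 hi, if_true, lt_irrefl, if_false]
      field_simp
      simp
  rw [e2] at h
  have e3 : ∀ i ∈ range N, (∏ j ∈ range (N+1), ((if i < N then z i else 0) - if j < N then q * z j else 1))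
      / ∏ j ∈ (range (N+1)).erase i, ((if i < N then z i else 0) - if j < N then z j else 0)
      = (1 - q) * ((z i - 1) * ∏ k ∈ (range N).erase i, ((z i - q * z k) / (z i - z k))) := by
    intro i hi
    have hiN := mem_range.1 hi
    have e4 : (range (N+1)).erase i = insert N ((range N).erase i) := by
      ext x; simp; omega
    rw [e4, prod_insert (by simp), prod_range_succ, ← mul_prod_erase _ _ hi]
    simp only [hiN, if_true, lt_irrefl, if_false]
    have a1 : ∏ j ∈ (range N).erase i, (z i - if j < N then q * z j else 1)
      = ∏ j ∈ (range N).erase i, (z i - q * z j) :=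
      prod_congr rfl (fun j hj => by rw [if_pos (mem_range.1 (mem_of_mem_erase hj))])
    have a2 : ∏ j ∈ (range N).erase i, (z i - if j < N then z j else 0)
      = ∏ j ∈ (range N).erase i, (z i - z j) :=
      prod_congr rfl (fun j hj => by rw [if_pos (mem_range.1 (mem_of_mem_erase hj))])
    rw [a1, a2, prod_div_distrib]
    have hp : ∏ j ∈ (range N).erase i, (z i - z j) ≠ 0 := by
      rw [prod_ne_zero_iff]
      intro j hj
      rw [sub_ne_zero]
      intro he
      have := hz (by simpa using hiN) (by simpa using mem_of_mem_erase hj) he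
      simp [this] at hj
    have := hz0 i hiN
    field_simp
    ring
  rw [sum_congr rfl e3, ← mul_sum, hlt, hlt] at h
  simp only [lt_irrefl, if_false] at h
  have hg := mul_neg_geom_sum q N
  have h1 : (1 - q) ≠ 0 := sub_ne_zero.2 (Ne.symm hq)
  apply mul_left_cancel₀ h1
  rw [mul_sub, hg, eq_sub_of_add_eq h]
  rw [← mul_sum]; ring

/-- bracket -/
def br (t : K) (n : ℤ) : K := t ^ n - t ^ (-n)

lemma br_neg (t : K) (n : ℤ) : br t (-n) = - br t n := by simp [br]

lemma br_zero (t : K) : br t 0 = 0 := by simp [br]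

lemma br_eq {t : K} (ht : t ≠ 0) (n : ℤ) : br t n = t ^ (-n) * (t ^ (2 * n) - 1) := by
  rw [mul_sub, ← zpow_add₀ ht, br]; ring_nf

lemma br_ne {t : K} (ht : t ≠ 0) (h1 : ∀ n : ℤ, n ≠ 0 → t ^ n ≠ 1) {n : ℤ} (hn : n ≠ 0) :
    br t n ≠ 0 := by
  rw [br_eq ht]
  exact mul_ne_zero (zpow_ne_zero _ ht) (sub_ne_zero.2 (h1 _ (by omega)))

lemma br_ratio {t : K} (ht : t ≠ 0) (h1 : ∀ n : ℤ, n ≠ 0 → t ^ n ≠ 1) {x y : ℤ} (hxy : x ≠ y) :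
    br t (x - 1 - y) / br t (x - y)
      = t⁻¹ * ((t ^ (2 * x) - t ^ 2 * t ^ (2 * y)) / (t ^ (2 * x) - t ^ (2 * y))) := by
  have h2 := br_ne ht h1 (sub_ne_zero.2 hxy)
  have h3 : t ^ (2 * x) - t ^ (2 * y) ≠ 0 := by
    intro h
    apply h1 (2 * x - 2 * y) (by omega)
    rw [zpow_sub₀ ht, sub_eq_zero.1 h, div_self (zpow_ne_zero _ ht)]
  rw [div_eq_iff h2, mul_assoc, div_mul_eq_mul_div, eq_inv_mul_iff_mul_eq₀ ht, eq_div_iff h3]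
  have e : ∀ w : ℤ, t ^ (2 * w) = (t ^ w) ^ 2 := fun w => by
    rw [mul_comm, zpow_mul]; norm_cast
  have hx := zpow_ne_zero x ht
  have hy := zpow_ne_zero y ht
  simp only [br, e, zpow_sub₀ ht, zpow_neg, zpow_one]
  field_simp

lemma T_sum (N : ℕ) (l : ℕ → ℤ) (t : K) (ht : t ≠ 0) (h1 : ∀ n : ℤ, n ≠ 0 → t ^ n ≠ 1)
    (hl : Set.InjOn l (range N)) :
    ∑ i ∈ range N, t ^ (l i - N) * (br t (l i) *
      ∏ k ∈ (range N).erase i, (br t (l i - 1 - l k) / br t (l i - l k)))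
    = t ^ (1 - 2 * (N : ℤ)) * (∑ i ∈ range N, t ^ (2 * l i) - ∑ i ∈ range N, (t ^ 2) ^ i) := by
  have hq : t ^ 2 ≠ 1 := by
    have := h1 2 (by norm_num); exact_mod_cast this
  rw [← key_id N (fun i => t ^ (2 * l i)) (t ^ 2) hq, mul_sum]
  · apply sum_congr rfl
    intro i hi
    have hk : ∀ k ∈ (range N).erase i, br t (l i - 1 - l k) / br t (l i - l k) =
      t⁻¹ * ((t ^ (2 * l i) - t ^ 2 * t ^ (2 * l k)) / (t ^ (2 * l i) - t ^ (2 * l k))) := by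
      intro k hk
      rw [br_ratio ht h1]
      intro he
      have := hl (by simpa using hi) (by simpa using mem_of_mem_erase hk) he
      simp [this] at hk
    rw [prod_congr rfl hk, prod_mul_distrib, prod_const, card_erase_of_mem hi, card_range,
      br_eq ht]
    have : t ^ (1 - 2 * (N : ℤ)) = t ^ (l i - N) * t ^ (- l i) * t⁻¹ ^ (N - 1) := by
      have hN := mem_range.1 hi
      rw [← zpow_natCast, inv_zpow, ← zpow_neg, ← zpow_add₀ ht, ← zpow_add₀ ht]
      congr 1
      omega
    rw [this]; ring
  · intro i hi j hj hij
    by_contra hne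
    apply h1 (2 * l i - 2 * l j)
    · intro h; exact hne (hl hi hj (by omega))
    · simp only at hij
      rw [zpow_sub₀ ht, hij, div_self (zpow_ne_zero _ ht)]
  · intro i _; exact zpow_ne_zero _ ht

end Alg

section Comb
variable {K : Type*} [Field K]

/-- beta numbers -/
def bl (μ : YoungDiagram) (N : ℕ) (i : ℕ) : ℤ := (μ.rowLen i : ℤ) + N - 1 - i

lemma bl_anti (μ : YoungDiagram) (N : ℕ) {i k : ℕ} (h : i < k) : bl μ N k < bl μ N i := by
  have := μ.rowLen_anti i k h.le
  unfold bl; omega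

lemma bl_inj (μ : YoungDiagram) (N : ℕ) : Function.Injective (bl μ N) := by
  intro i k h
  rcases lt_trichotomy i k with h1 | h1 | h1
  · have := bl_anti μ N h1; omega
  · exact h1
  · have := bl_anti μ N h1; omega

lemma mem_iff_row_col (μ : YoungDiagram) (i j : ℕ) : j < μ.rowLen i ↔ i < μ.colLen j := by
  rw [← YoungDiagram.mem_iff_lt_rowLen, YoungDiagram.mem_iff_lt_colLen]

lemma rowLen_zero_of (μ : YoungDiagram) {N : ℕ} (hN : μ.colLen 0 ≤ N) {i : ℕ} (hi : N ≤ i) :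
    μ.rowLen i = 0 := by
  by_contra h
  have := (mem_iff_row_col μ i 0).1 (Nat.pos_of_ne_zero h)
  omega

lemma hook_val (μ : YoungDiagram) {i j : ℕ} (h : j < μ.rowLen i) :
    (hookLen μ (i, j) : ℤ) = (μ.rowLen i : ℤ) - j + μ.colLen j - i - 1 := by
  have := (mem_iff_row_col μ i j).1 h
  simp only [hookLen, armLen, legLen]
  omega

lemma hook_row (μ : YoungDiagram) (N : ℕ) (hN : μ.colLen 0 ≤ N) (f : ℤ → K) {i : ℕ} (hi : i < N) :
    (∏ j ∈ range (μ.rowLen i), f (hookLen μ (i, j))) * ∏ k ∈ Ioo i N, f (bl μ N i - bl μ N k)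
      = ∏ m ∈ Icc 1 (bl μ N i), f m := by
  classical
  have i1 : Set.InjOn (fun j => (hookLen μ (i, j) : ℤ)) (range (μ.rowLen i)) := by
    intro j hj k hk h
    simp only [coe_range, Set.mem_Iio] at hj hk
    simp only [hook_val μ hj, hook_val μ hk] at h
    rcases lt_trichotomy j k with h1 | h1 | h1
    · have := μ.colLen_anti j k h1.le; omega
    · exact h1
    · have := μ.colLen_anti k j h1.le; omega
  have i2 : Set.InjOn (fun k => bl μ N i - bl μ N k) (Ioo i N) := by
    intro j _ k _ h
    exact bl_inj μ N (by simp only at h; omega)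
  have hd : Disjoint ((range (μ.rowLen i)).image (fun j => (hookLen μ (i, j) : ℤ)))
      ((Ioo i N).image (fun k => bl μ N i - bl μ N k)) := by
    rw [disjoint_left]
    intro x hx hx'
    simp only [mem_image, mem_range, mem_Ioo] at hx hx'
    obtain ⟨j, hj, rfl⟩ := hx
    obtain ⟨k, hk, h⟩ := hx'
    rw [hook_val μ hj] at h
    have := mem_iff_row_col μ k j
    unfold bl at h
    by_cases hc : j < μ.rowLen k
    · have := this.1 hc; omega
    · have : ¬ k < μ.colLen j := fun h' => hc (this.2 h')
      omega
  rw [← prod_image i1, ← prod_image i2, ← prod_union hd]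
  apply prod_congr _ (fun _ _ => rfl)
  apply eq_of_subset_of_card_le
  · intro x hx
    simp only [mem_union, mem_image, mem_range, mem_Ioo] at hx
    rw [mem_Icc]
    rcases hx with ⟨j, hj, rfl⟩ | ⟨k, hk, rfl⟩
    · have h1 := (mem_iff_row_col μ i j).1 hj
      have h2 := μ.colLen_anti 0 j (Nat.zero_le _)
      rw [hook_val μ hj]
      unfold bl
      omega
    · have := bl_anti μ N hk.1
      refine ⟨by omega, ?_⟩
      unfold bl; omega
  · rw [card_union_of_disjoint hd, card_image_of_injOn i1, card_image_of_injOn i2]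
    simp only [card_range, Nat.card_Ioo, Int.card_Icc]
    unfold bl; omega

/-- hook product -/
def hookProd (t : K) (μ : YoungDiagram) : K := ∏ c ∈ μ.cells, br t (hookLen μ c)

lemma prod_cells (μ : YoungDiagram) (N : ℕ) (hN : μ.colLen 0 ≤ N) (f : ℕ × ℕ → K) :
    ∏ c ∈ μ.cells, f c = ∏ i ∈ range N, ∏ j ∈ range (μ.rowLen i), f (i, j) := by
  apply prod_finset_product
  rintro ⟨i, j⟩
  simp only [YoungDiagram.mem_cells, mem_range]
  rw [YoungDiagram.mem_iff_lt_rowLen]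
  refine ⟨fun h => ⟨?_, h⟩, fun h => h.2⟩
  by_contra hc
  have := rowLen_zero_of μ hN (not_lt.1 hc)
  omega

lemma sum_cells (μ : YoungDiagram) (N : ℕ) (hN : μ.colLen 0 ≤ N) (f : ℕ × ℕ → K) :
    ∑ c ∈ μ.cells, f c = ∑ i ∈ range N, ∑ j ∈ range (μ.rowLen i), f (i, j) := by
  apply sum_finset_product
  rintro ⟨i, j⟩
  simp only [YoungDiagram.mem_cells, mem_range]
  rw [YoungDiagram.mem_iff_lt_rowLen]
  refine ⟨fun h => ⟨?_, h⟩, fun h => h.2⟩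
  by_contra hc
  have := rowLen_zero_of μ hN (not_lt.1 hc)
  omega

lemma hookProd_mul (t : K) (μ : YoungDiagram) (N : ℕ) (hN : μ.colLen 0 ≤ N) :
    hookProd t μ * ∏ i ∈ range N, ∏ k ∈ Ioo i N, br t (bl μ N i - bl μ N k)
      = ∏ i ∈ range N, ∏ m ∈ Icc 1 (bl μ N i), br t m := by
  rw [hookProd, prod_cells μ N hN, ← prod_mul_distrib]
  exact prod_congr rfl (fun i hi => hook_row μ N hN (br t) (mem_range.1 hi))

lemma prod_pairs (N r : ℕ) (hr : r < N) (R : ℕ → ℕ → K) (hs : ∀ i k, R i k = R k i)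
    (h1 : ∀ i k, i ≠ r → k ≠ r → R i k = 1) :
    ∏ i ∈ range N, ∏ k ∈ Ioo i N, R i k = ∏ k ∈ (range N).erase r, R r k := by
  classical
  have e : (range N).erase r = range r ∪ Ioo r N := by
    ext x; simp; omega
  have hd : Disjoint (range r) (Ioo r N) := by
    rw [disjoint_left]; intro x; simp; omega
  rw [← mul_prod_erase _ _ (mem_range.2 hr), e, prod_union hd, prod_union hd, mul_comm]
  have a1 : ∀ i ∈ range r, ∏ k ∈ Ioo i N, R i k = R r i := by
    intro i hi
    have hi := mem_range.1 hi
    rw [prod_eq_single r, hs]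
    · intro k hk hkr; exact h1 i k hi.ne hkr
    · intro h; exact absurd (mem_Ioo.2 ⟨hi, hr⟩) h
  have a2 : ∀ i ∈ Ioo r N, ∏ k ∈ Ioo i N, R i k = 1 := by
    intro i hi
    have hi := mem_Ioo.1 hi
    apply prod_eq_one
    intro k hk
    have hk := mem_Ioo.1 hk
    exact h1 i k (by omega) (by omega)
  rw [prod_congr rfl a1, prod_congr rfl a2]
  simp

/-- `r` is a removable row -/
def remCells (μ : YoungDiagram) (r : ℕ) (h : μ.rowLen (r+1) < μ.rowLen r) : YoungDiagram where
  cells := μ.cells.erase (r, μ.rowLen r - 1)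
  isLowerSet := by
    rintro ⟨a, b⟩ ⟨c, d⟩ hle hab
    simp only [coe_erase, Set.mem_sdiff, mem_coe, YoungDiagram.mem_cells,
      Set.mem_singleton_iff, Prod.mk.injEq, YoungDiagram.mem_iff_lt_rowLen] at hab ⊢
    obtain ⟨h1, h2⟩ := Prod.mk_le_mk.1 hle
    have h3 := μ.rowLen_anti c a h1
    refine ⟨by omega, ?_⟩
    rintro ⟨rfl, rfl⟩
    apply hab.2
    by_cases hac : a = c
    · subst hac; exact ⟨rfl, by omega⟩
    · have := μ.rowLen_anti (c+1) a (by omega)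
      omega

lemma rowLen_rem (μ : YoungDiagram) (r : ℕ) (h : μ.rowLen (r+1) < μ.rowLen r) (i : ℕ) :
    (remCells μ r h).rowLen i = if i = r then μ.rowLen r - 1 else μ.rowLen i := by
  have key : ∀ j, j < (remCells μ r h).rowLen i ↔
      j < if i = r then μ.rowLen r - 1 else μ.rowLen i := by
    intro j
    rw [← YoungDiagram.mem_iff_lt_rowLen]
    change (i, j) ∈ μ.cells.erase (r, μ.rowLen r - 1) ↔ _
    rw [mem_erase, YoungDiagram.mem_cells, YoungDiagram.mem_iff_lt_rowLen]
    split_ifs with hi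
    · subst hi; simp; omega
    · simp [hi]
  apply le_antisymm
  · by_contra hc
    have := (key _).1 (not_le.1 hc); omega
  · by_contra hc
    have := (key _).2 (not_le.1 hc); omega

lemma bl_rem (μ : YoungDiagram) (N r : ℕ) (h : μ.rowLen (r+1) < μ.rowLen r) (i : ℕ) :
    bl (remCells μ r h) N i = if i = r then bl μ N r - 1 else bl μ N i := by
  unfold bl; rw [rowLen_rem]
  split_ifs with hi
  · subst hi; omega
  · rfl

lemma colLen_rem (μ : YoungDiagram) (r : ℕ) (h : μ.rowLen (r+1) < μ.rowLen r) (j : ℕ) :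
    (remCells μ r h).colLen j ≤ μ.colLen j := by
  by_contra hc
  have := (mem_iff_row_col _ _ _).2 (not_le.1 hc)
  rw [rowLen_rem] at this
  have h2 : j < μ.rowLen (μ.colLen j) := by
    split_ifs at this with hh
    · rw [hh]; omega
    · exact this
  have := (mem_iff_row_col _ _ _).1 h2
  omega

lemma hookProd_ne (t : K) (ht : t ≠ 0) (h1 : ∀ n : ℤ, n ≠ 0 → t ^ n ≠ 1) (μ : YoungDiagram) :
    hookProd t μ ≠ 0 := by
  rw [hookProd, prod_ne_zero_iff]
  intro c _
  apply br_ne ht h1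
  unfold hookLen; omega

lemma hookProd_rem (t : K) (ht : t ≠ 0) (h1 : ∀ n : ℤ, n ≠ 0 → t ^ n ≠ 1) (μ : YoungDiagram)
    (N r : ℕ) (hN : μ.colLen 0 ≤ N) (h : μ.rowLen (r+1) < μ.rowLen r) (hr : r < N) :
    (hookProd t (remCells μ r h))⁻¹ = (hookProd t μ)⁻¹ * (br t (bl μ N r) *
      ∏ k ∈ (range N).erase r, (br t (bl μ N r - 1 - bl μ N k) / br t (bl μ N r - bl μ N k))) := by
  have A := hookProd_mul t μ N hN
  have B := hookProd_mul t (remCells μ r h) N ((colLen_rem μ r h 0).trans hN)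
  set l := bl μ N with hl
  set l' := bl (remCells μ r h) N with hl'
  have hll : ∀ i, l' i = if i = r then l r - 1 else l i := bl_rem μ N r h
  have linj : ∀ i k, i ≠ k → br t (l i - l k) ≠ 0 := by
    intro i k hik
    apply br_ne ht h1
    intro hc
    exact hik (bl_inj μ N (by rw [← hl]; omega))
  have hVne : ∏ i ∈ range N, ∏ k ∈ Ioo i N, br t (l i - l k) ≠ 0 := by
    rw [prod_ne_zero_iff]; intro i _
    rw [prod_ne_zero_iff]; intro k hk
    exact linj i k (mem_Ioo.1 hk).1.ne
  have hV : (∏ i ∈ range N, ∏ k ∈ Ioo i N, br t (l' i - l' k)) =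
      (∏ k ∈ (range N).erase r, (br t (l r - 1 - l k) / br t (l r - l k))) *
      ∏ i ∈ range N, ∏ k ∈ Ioo i N, br t (l i - l k) := by
    rw [← div_eq_iff hVne, ← prod_div_distrib]
    simp only [← prod_div_distrib]
    have P := prod_pairs N r hr (fun i k => if i = k then 1 else
      br t (l' i - l' k) / br t (l i - l k)) ?_ ?_
    · rw [prod_congr rfl (fun i _ => prod_congr rfl (fun k hk => ?_))] at P
      rw [P]
      · apply prod_congr rfl
        intro k hk
        have hk := (mem_erase.1 hk).1
        rw [if_neg hk.symm, hll, hll, if_pos rfl, if_neg hk]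
      · exact if_neg (mem_Ioo.1 hk).1.ne
    · intro i k
      by_cases hik : i = k
      · subst hik; rfl
      · simp only [if_neg hik, if_neg (Ne.symm hik)]
        rw [← neg_sub (l' k), ← neg_sub (l k), br_neg, br_neg, neg_div_neg_eq]
    · intro i k hi hk
      by_cases hik : i = k
      · simp [hik]
      · simp only [if_neg hik]
        rw [hll, hll, if_neg hi, if_neg hk, div_self (linj i k hik)]
  have hP : ∏ i ∈ range N, ∏ m ∈ Icc 1 (l i), br t m =
      br t (l r) * ∏ i ∈ range N, ∏ m ∈ Icc 1 (l' i), br t m := by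
    rw [← mul_prod_erase _ _ (mem_range.2 hr), ← mul_prod_erase _ _ (mem_range.2 hr), ← mul_assoc]
    congr 1
    · rw [hll, if_pos rfl]
      have : Icc 1 (l r) = insert (l r) (Icc 1 (l r - 1)) := by
        have : 1 ≤ l r := by rw [hl]; unfold bl; omega
        ext x; simp; omega
      rw [this, prod_insert (by simp)]
    · apply prod_congr rfl
      intro i hi
      rw [hll, if_neg (mem_erase.1 hi).1]
  have d1 := hookProd_ne t ht h1 μ
  have d2 := hookProd_ne t ht h1 (remCells μ r h)
  rw [inv_eq_iff_eq_inv, mul_inv, inv_inv, eq_mul_inv_iff_mul_eq₀]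
  · apply mul_right_cancel₀ hVne
    rw [A, hP, ← B, hV]; ring
  · intro hc
    rw [← B, hV] at hP
    rw [hP] at A
    have : hookProd t μ * ∏ i ∈ range N, ∏ k ∈ Ioo i N, br t (l i - l k) = 0 := by
      rw [A]
      linear_combination (hookProd t (remCells μ r h) *
        ∏ i ∈ range N, ∏ k ∈ Ioo i N, br t (l i - l k)) * hc
    exact mul_ne_zero d1 hVne this

end Comb

section Main
variable {K : Type*} [Field K]

/-- remove the last cell of row `r` if possible -/
def remRow (μ : YoungDiagram) (r : ℕ) : YoungDiagram :=
  if h : μ.rowLen (r+1) < μ.rowLen r then remCells μ r h else μ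

/-- the removable rows -/
def remSet (μ : YoungDiagram) : Finset ℕ :=
  (range (μ.colLen 0)).filter (fun r => μ.rowLen (r+1) < μ.rowLen r)

lemma content_sum (t : K) (ht : t ≠ 0) (μ : YoungDiagram) (N : ℕ) (hN : μ.colLen 0 ≤ N) :
    (t - t⁻¹) * ∑ c ∈ μ.cells, t ^ (2 * cellContent c)
      = t ^ (1 - 2 * (N : ℤ)) * (∑ i ∈ range N, t ^ (2 * bl μ N i) - ∑ i ∈ range N, (t ^ 2) ^ i) := by
  rw [sum_cells μ N hN, ← sum_range_reflect (fun i => (t ^ 2) ^ i), ← sum_sub_distrib, mul_sum,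
    mul_sum]
  apply sum_congr rfl
  intro i hi
  have hi := mem_range.1 hi
  have e : ∀ j ∈ range (μ.rowLen i), t ^ (2 * cellContent (i, j)) = t ^ (-2 * (i : ℤ)) * (t ^ 2) ^ j := by
    intro j _
    rw [← pow_mul, ← zpow_natCast t, ← zpow_add₀ ht]
    congr 1
    simp only [cellContent]; push_cast; ring
  rw [sum_congr rfl e, ← mul_sum]
  have g := mul_geom_sum (t ^ 2) (μ.rowLen i)
  have e1 : t - t⁻¹ = t⁻¹ * (t ^ 2 - 1) := by field_simp
  rw [e1]
  calc t⁻¹ * (t ^ 2 - 1) * (t ^ (-2 * (i : ℤ)) * ∑ j ∈ range (μ.rowLen i), (t ^ 2) ^ j)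
      = t⁻¹ * t ^ (-2 * (i : ℤ)) * ((t ^ 2 - 1) * ∑ j ∈ range (μ.rowLen i), (t ^ 2) ^ j) := by ring
    _ = _ := by
      rw [g, mul_sub, mul_sub, ← pow_mul, ← pow_mul, ← zpow_natCast t, ← zpow_natCast t,
        ← zpow_neg_one, ← zpow_add₀ ht, ← zpow_add₀ ht, ← zpow_add₀ ht, ← zpow_add₀ ht, mul_one]
      unfold bl
      congr 2
      · push_cast; ring
      · push_cast [Nat.sub_sub, Nat.cast_sub (show 1 + i ≤ N by omega)]; ring

lemma main_id (t : K) (ht : t ≠ 0) (h1 : ∀ n : ℤ, n ≠ 0 → t ^ n ≠ 1) (μ : YoungDiagram) :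
    ∑ r ∈ remSet μ, t ^ ((μ.rowLen r : ℤ) - 1 - r) * (hookProd t (remRow μ r))⁻¹
      = (t - t⁻¹) * (∑ c ∈ μ.cells, t ^ (2 * cellContent c)) * (hookProd t μ)⁻¹ := by
  set N := μ.colLen 0 with hN
  rw [content_sum t ht μ N le_rfl, ← T_sum N (bl μ N) t ht h1 (bl_inj μ N).injOn, sum_mul,
    remSet, sum_filter]
  apply sum_congr rfl
  intro r hr
  have hrN := mem_range.1 hr
  split_ifs with h
  · rw [remRow, dif_pos h, hookProd_rem t ht h1 μ N r le_rfl h hrN]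
    have : (μ.rowLen r : ℤ) - 1 - r = bl μ N r - N := by unfold bl; ring
    rw [this]; ring
  · have hle := μ.rowLen_anti r (r+1) (by omega)
    have hr1 : r + 1 < N := by
      by_contra hc
      have z := rowLen_zero_of μ (N := N) le_rfl (not_lt.1 hc)
      have := (mem_iff_row_col μ r 0).2 hrN
      omega
    rw [prod_eq_zero (i := r + 1)]
    · simp
    · simp; omega
    · have : bl μ N r - 1 - bl μ N (r+1) = 0 := by unfold bl; push_cast; omega
      rw [this, br_zero, zero_div]

lemma mem_remSet {μ : YoungDiagram} {r : ℕ} (h : r ∈ remSet μ) : μ.rowLen (r+1) < μ.rowLen r :=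
  (mem_filter.1 h).2

lemma remRow_cells {μ : YoungDiagram} {r : ℕ} (h : r ∈ remSet μ) :
    (remRow μ r).cells = μ.cells.erase (r, μ.rowLen r - 1) := by
  rw [remRow, dif_pos (mem_remSet h)]; rfl

lemma corner_mem {μ : YoungDiagram} {r : ℕ} (h : r ∈ remSet μ) :
    (r, μ.rowLen r - 1) ∈ μ.cells := by
  have := mem_remSet h
  rw [YoungDiagram.mem_cells, YoungDiagram.mem_iff_lt_rowLen]; omega

lemma addCell_set (μ : YoungDiagram) : {l : YoungDiagram | AddCell l μ} = remRow μ '' (remSet μ) := by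
  ext l
  simp only [Set.mem_setOf_eq, Set.mem_image, mem_coe]
  constructor
  · rintro ⟨hs, hc⟩
    have h1 : #(μ.cells \ l.cells) = 1 := by
      rw [card_sdiff_of_subset hs]
      change #μ.cells = #l.cells + 1 at hc
      omega
    obtain ⟨⟨r, s⟩, hx⟩ := card_eq_one.1 h1
    have hm : (r, s) ∈ μ.cells ∧ (r, s) ∉ l.cells := by
      rw [← mem_sdiff, hx]; simp
    have hiff : ∀ c ∈ μ.cells, c ∉ l.cells → c = (r, s) := by
      intro c h2 h3
      have : c ∈ μ.cells \ l.cells := mem_sdiff.2 ⟨h2, h3⟩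
      rw [hx] at this; simpa using this
    have hsl : s < μ.rowLen r := by
      rw [← YoungDiagram.mem_iff_lt_rowLen]; exact hm.1
    have hnr : (r, s + 1) ∉ μ.cells := by
      intro hh
      have : (r, s + 1) ∉ l.cells := fun h2 =>
        hm.2 (l.up_left_mem (le_refl r) (Nat.le_succ s) h2)
      have := hiff _ hh this
      simp at this
    have hnd : (r + 1, s) ∉ μ.cells := by
      intro hh
      have : (r + 1, s) ∉ l.cells := fun h2 =>
        hm.2 (l.up_left_mem (Nat.le_succ r) (le_refl s) h2)
      have := hiff _ hh this
      simp at this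
    rw [YoungDiagram.mem_cells, YoungDiagram.mem_iff_lt_rowLen] at hnr hnd
    have hmem : r ∈ remSet μ := by
      refine mem_filter.2 ⟨mem_range.2 ?_, by omega⟩
      rw [← mem_iff_row_col]; omega
    refine ⟨r, hmem, ?_⟩
    apply YoungDiagram.ext
    rw [remRow_cells hmem, show μ.rowLen r - 1 = s by omega]
    ext c
    rw [mem_erase]
    constructor
    · rintro ⟨h2, h3⟩
      by_contra h4
      exact h2 (hiff c h3 h4)
    · intro h2
      refine ⟨?_, hs h2⟩
      rintro rfl
      exact hm.2 h2
  · rintro ⟨r, hr, rfl⟩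
    refine ⟨?_, ?_⟩
    · rw [remRow_cells hr]; exact erase_subset _ _
    · change #μ.cells = #(remRow μ r).cells + 1
      rw [remRow_cells hr, card_erase_add_one (corner_mem hr)]

lemma sdiff_rem {μ : YoungDiagram} {r : ℕ} (h : r ∈ remSet μ) :
    μ.cells \ (remRow μ r).cells = {(r, μ.rowLen r - 1)} := by
  rw [remRow_cells h]
  exact sdiff_erase_self (corner_mem h)

lemma remRow_inj (μ : YoungDiagram) : Set.InjOn (remRow μ) (remSet μ) := by
  intro r hr s hs h
  have h1 := sdiff_rem hr
  rw [h, sdiff_rem hs] at h1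
  have := singleton_injective h1
  exact (Prod.mk.inj this).1.symm

lemma newContent_rem {μ : YoungDiagram} {r : ℕ} (h : r ∈ remSet μ) :
    newContent (remRow μ r) μ = (μ.rowLen r : ℤ) - 1 - r := by
  have := mem_remSet h
  rw [newContent, sdiff_rem h, sum_singleton, cellContent]
  simp only
  omega

lemma solve_gen (t a γ : K) (ht : t ≠ 0) (h1 : ∀ n : ℤ, n ≠ 0 → t ^ n ≠ 1)
    (hC : ∀ μ : YoungDiagram, μ.cells.Nonempty → ∑ c ∈ μ.cells, t ^ (2 * cellContent c) ≠ 0)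
    (ψ : YoungDiagram → K)
    (hrec : ∀ μ : YoungDiagram, μ.cells.Nonempty →
      (t - t⁻¹) * (∑ c ∈ μ.cells, t ^ (2 * cellContent c)) * ψ μ =
        γ * ∑ᶠ l ∈ {l : YoungDiagram | AddCell l μ},
          (a - a⁻¹ * t ^ (2 * newContent l μ)) * ψ l) (n : ℕ) :
    ∀ l : YoungDiagram, l.card = n →
      ψ l = ψ ⊥ * (γ ^ l.card * ((∏ c ∈ l.cells,
        (a * t ^ (-cellContent c) - a⁻¹ * t ^ cellContent c)) * (hookProd t l)⁻¹)) := by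
  induction n with
  | zero =>
    intro l hl
    have : l = ⊥ := by
      apply YoungDiagram.ext
      exact card_eq_zero.1 hl
    subst this
    simp [hookProd, YoungDiagram.card]
  | succ n ih =>
    intro μ hμ
    have hne : μ.cells.Nonempty := by
      rw [← card_pos]; change 0 < μ.card; omega
    have hr := hrec μ hne
    rw [addCell_set, finsum_mem_image (remRow_inj μ), finsum_mem_coe_finset] at hr
    set Pa : K := ∏ c ∈ μ.cells, (a * t ^ (-cellContent c) - a⁻¹ * t ^ cellContent c) with hPa
    have hterm : ∀ r ∈ remSet μ, (a - a⁻¹ * t ^ (2 * newContent (remRow μ r) μ)) * ψ (remRow μ r)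
        = (ψ ⊥ * γ ^ n * Pa) * (t ^ ((μ.rowLen r : ℤ) - 1 - r) * (hookProd t (remRow μ r))⁻¹) := by
      intro r hr
      have hc : (remRow μ r).card = n := by
        have : #(remRow μ r).cells + 1 = #μ.cells := by
          rw [remRow_cells hr, card_erase_add_one (corner_mem hr)]
        change #(remRow μ r).cells = n
        change #μ.cells = n + 1 at hμ
        omega
      rw [ih _ hc, hc, newContent_rem hr, hPa, ← mul_prod_erase _ _ (corner_mem hr),
        remRow_cells hr]
      have hcc : cellContent (r, μ.rowLen r - 1) = (μ.rowLen r : ℤ) - 1 - r := by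
        have := mem_remSet hr
        simp only [cellContent]; omega
      rw [hcc]
      set m : ℤ := (μ.rowLen r : ℤ) - 1 - r
      have e2 : t ^ (2 * m) = t ^ m * t ^ m := by rw [← zpow_add₀ ht]; ring_nf
      have e3 : t ^ (-m) * t ^ m = 1 := by rw [← zpow_add₀ ht]; simp
      have e4 : a - a⁻¹ * t ^ (2 * m) = (a * t ^ (-m) - a⁻¹ * t ^ m) * t ^ m := by
        rw [e2]; linear_combination (-a) * e3
      rw [e4]; ring
    rw [sum_congr rfl hterm, ← mul_sum, main_id t ht h1] at hr
    have hb : t - t⁻¹ ≠ 0 := by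
      have := br_ne ht h1 one_ne_zero
      simpa [br] using this
    apply mul_left_cancel₀ (mul_ne_zero hb (hC μ hne))
    rw [hr, hμ, pow_succ]; ring

end Main

lemma vt_ne : vt ≠ 0 := RatFunc.X_ne_zero

lemma vt_pow (n : ℕ) : vt ^ n = algebraMap (Polynomial (RatFunc ℚ)) F2 (Polynomial.X ^ n) := by
  rw [map_pow, RatFunc.algebraMap_X]; rfl

lemma vt_npow_ne (n : ℕ) (hn : n ≠ 0) : vt ^ n ≠ 1 := by
  rw [vt_pow, ← map_one (algebraMap (Polynomial (RatFunc ℚ)) F2)]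
  intro h
  have h2 := RatFunc.algebraMap_injective _ h
  have := congrArg Polynomial.natDegree h2
  simp at this
  exact hn this

lemma vt_zpow_ne (n : ℤ) (hn : n ≠ 0) : vt ^ n ≠ 1 := by
  rcases Int.natAbs_eq n with h | h
  · rw [h, zpow_natCast]; exact vt_npow_ne _ (by omega)
  · rw [h, zpow_neg, zpow_natCast, ne_eq, inv_eq_one]; exact vt_npow_ne _ (by omega)

lemma content_ne (μ : YoungDiagram) (hμ : μ.cells.Nonempty) :
    ∑ c ∈ μ.cells, vt ^ (2 * cellContent c) ≠ 0 := by
  intro h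
  set M := ∑ c ∈ μ.cells, c.1 with hM
  have hle : ∀ c ∈ μ.cells, c.1 ≤ M := fun c hc =>
    single_le_sum (f := fun c : ℕ × ℕ => c.1) (fun _ _ => Nat.zero_le _) hc
  have h2 : ∑ c ∈ μ.cells, vt ^ (2 * (c.2 + M - c.1)) = 0 := by
    have : ∑ c ∈ μ.cells, vt ^ (2 * (c.2 + M - c.1)) =
        vt ^ (2 * M) * ∑ c ∈ μ.cells, vt ^ (2 * cellContent c) := by
      rw [mul_sum]
      apply sum_congr rfl
      intro c hc
      have := hle c hc
      rw [← zpow_natCast, ← zpow_natCast, ← zpow_add₀ vt_ne]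
      congr 1
      unfold cellContent
      omega
    rw [this, h, mul_zero]
  simp only [vt_pow] at h2
  rw [← map_sum, ← map_zero (algebraMap (Polynomial (RatFunc ℚ)) F2)] at h2
  have h3 := congrArg (Polynomial.eval 1) (RatFunc.algebraMap_injective _ h2)
  simp [Polynomial.eval_finset_sum] at h3
  simp [h3] at hμ

/-- Uniqueness: any solution of the recursion for the unknot conormal is `ψ_∅` times
the hook-content solution. -/
theorem unknot_recursion_unique (γ : F2) (ψ : YoungDiagram → F2)
    (hrec : ∀ μ : YoungDiagram, μ.cells.Nonempty →
      (vt - vt⁻¹) * contentPolyT2 μ * ψ μ =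
        γ * ∑ᶠ l ∈ {l : YoungDiagram | AddCell l μ},
          (va - va⁻¹ * vt ^ (2 * newContent l μ)) * ψ l) :
    ∀ l : YoungDiagram,
      ψ l = ψ ⊥ * (γ ^ l.card * ∏ c ∈ l.cells,
        (va * vt ^ (-cellContent c) - va⁻¹ * vt ^ cellContent c) /
          (vt ^ (hookLen l c : ℤ) - vt ^ (-(hookLen l c : ℤ)))) := by
  intro l
  rw [prod_div_distrib, div_eq_mul_inv]
  exact solve_gen vt va γ vt_ne vt_zpow_ne content_ne ψ hrec l.card l rfl
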